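/- arXiv:1801.03071 — 2 statements merged into one kernel-verified Lean document; each statement's English description precedes it below -/
import Mathlib

section
/- Tripartite monogamy with one shared qubit: For every 5-qubit density matrix ρ, the xy-plane Bell strengths of the triples (1,2,3) and (1,4,5) satisfy 𝒯²₁₂₃(ρ) + 𝒯²₁₄₅(ρ) ≤ 4. -/
open Matrix Complex ComplexOrder

noncomputable section

/-- The Pauli X matrix. -/
def pX : Matrix (Fin 2) (Fin 2) ℂ := !![0, 1; 1, 0]

/-- The Pauli Y matrix. -/
def pY : Matrix (Fin 2) (Fin 2) ℂ := !![0, -Complex.I; Complex.I, 0]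

/-- The Pauli Z matrix. -/
def pZ : Matrix (Fin 2) (Fin 2) ℂ := !![1, 0; 0, -1]

/-- The operator on `n` qubits acting as the single-qubit operator `M` on qubit `i`
and as the identity on all other qubits. -/
def onQubit {n : ℕ} (M : Matrix (Fin 2) (Fin 2) ℂ) (i : Fin n) :
    Matrix (Fin n → Fin 2) (Fin n → Fin 2) ℂ :=
  Matrix.of fun a b => ∏ s, if s = i then M (a s) (b s) else (if a s = b s then 1 else 0)

/-- An `n`-qubit density matrix: positive semidefinite with unit trace. -/
def IsDensityMatrix {n : ℕ} (ρ : Matrix (Fin n → Fin 2) (Fin n → Fin 2) ℂ) : Prop :=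
  ρ.PosSemidef ∧ ρ.trace = 1

/-- The two Pauli matrices spanning the xy plane. -/
def XY : Fin 2 → Matrix (Fin 2) (Fin 2) ℂ := ![pX, pY]

/-- The two Pauli matrices spanning the xz plane. -/
def XZ : Fin 2 → Matrix (Fin 2) (Fin 2) ℂ := ![pX, pZ]

/-- The xy-plane Bell strength 𝒯²_{ij}(ρ) of the pair of qubits (i,j). -/
def T2pair {n : ℕ} (ρ : Matrix (Fin n → Fin 2) (Fin n → Fin 2) ℂ) (i j : Fin n) : ℝ :=
  ∑ k : Fin 2, ∑ l : Fin 2,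
    ((ρ * (onQubit (XY k) i * onQubit (XY l) j)).trace.re) ^ 2

/-- The xy-plane Bell strength 𝒯²_{ijm}(ρ) of the triple of qubits (i,j,m). -/
def T2triple {n : ℕ} (ρ : Matrix (Fin n → Fin 2) (Fin n → Fin 2) ℂ) (i j m : Fin n) : ℝ :=
  ∑ k : Fin 2, ∑ l : Fin 2, ∑ p : Fin 2,
    ((ρ * (onQubit (XY k) i * onQubit (XY l) j * onQubit (XY p) m)).trace.re) ^ 2

/-- The xy-plane Bell strength 𝒯²_{ijml}(ρ) of the quadruple of qubits (i,j,m,l). -/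
def T2quad {n : ℕ} (ρ : Matrix (Fin n → Fin 2) (Fin n → Fin 2) ℂ) (i j m l : Fin n) : ℝ :=
  ∑ k : Fin 2, ∑ k' : Fin 2, ∑ k'' : Fin 2, ∑ k''' : Fin 2,
    ((ρ * (onQubit (XY k) i * onQubit (XY k') j * onQubit (XY k'') m *
        onQubit (XY k''') l)).trace.re) ^ 2

/-- The xz-plane Bell strength of the pair of qubits (i,j). -/
def T2pairXZ {n : ℕ} (ρ : Matrix (Fin n → Fin 2) (Fin n → Fin 2) ℂ) (i j : Fin n) : ℝ :=
  ∑ k : Fin 2, ∑ l : Fin 2,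
    ((ρ * (onQubit (XZ k) i * onQubit (XZ l) j)).trace.re) ^ 2

/-- The tensor product of a family of single-qubit operators. -/
def piKron {n : ℕ} (M : Fin n → Matrix (Fin 2) (Fin 2) ℂ) :
    Matrix (Fin n → Fin 2) (Fin n → Fin 2) ℂ :=
  Matrix.of fun a b => ∏ s, M s (a s) (b s)

lemma onQubit_eq_piKron {n : ℕ} (M : Matrix (Fin 2) (Fin 2) ℂ) (i : Fin n) :
    onQubit M i = piKron (fun s => if s = i then M else 1) := by
  ext a b
  simp only [onQubit, piKron, Matrix.of_apply]
  refine Finset.prod_congr rfl fun s _ => ?_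
  split_ifs with h <;> simp_all [Matrix.one_apply]

lemma piKron_mul {n : ℕ} (M N : Fin n → Matrix (Fin 2) (Fin 2) ℂ) :
    piKron M * piKron N = piKron (fun s => M s * N s) := by
  ext a b
  simp only [piKron, Matrix.mul_apply, Matrix.of_apply, ← Finset.prod_mul_distrib]
  rw [Finset.prod_univ_sum, Fintype.piFinset_univ]

lemma piKron_one {n : ℕ} : piKron (fun _ : Fin n => 1) = 1 := by
  ext a b
  simp only [piKron, Matrix.of_apply, Matrix.one_apply, funext_iff]
  split_ifs with h
  · simp [h]
  · obtain ⟨s, hs⟩ := not_forall.mp h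
    exact Finset.prod_eq_zero (Finset.mem_univ s) (by simp [hs])

lemma piKron_isHermitian {n : ℕ} {M : Fin n → Matrix (Fin 2) (Fin 2) ℂ}
    (h : ∀ s, (M s).IsHermitian) : (piKron M).IsHermitian := by
  ext a b
  simp only [piKron, Matrix.conjTranspose_apply, Matrix.of_apply, star_prod]
  exact Finset.prod_congr rfl fun s _ => (h s).apply _ _

lemma piKron_anticomm {n : ℕ} {M N : Fin n → Matrix (Fin 2) (Fin 2) ℂ} (i : Fin n)
    (hi : M i * N i = -(N i * M i)) (h : ∀ s, s ≠ i → M s * N s = N s * M s) :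
    piKron M * piKron N = -(piKron N * piKron M) := by
  rw [piKron_mul, piKron_mul]
  ext a b
  simp only [piKron, Matrix.of_apply, Matrix.neg_apply]
  rw [← Finset.mul_prod_erase _ _ (Finset.mem_univ i),
    ← Finset.mul_prod_erase Finset.univ (fun s => (N s * M s) (a s) (b s)) (Finset.mem_univ i), hi,
    Matrix.neg_apply, neg_mul]
  congr 2
  exact Finset.prod_congr rfl fun s hs => by rw [h s (Finset.ne_of_mem_erase hs)]

lemma XY_isHermitian (k : Fin 2) : (XY k).IsHermitian := by
  fin_cases k <;> ext i j <;> fin_cases i <;> fin_cases j <;> simp [XY, pX, pY]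

lemma XY_mul_self (k : Fin 2) : XY k * XY k = 1 := by
  fin_cases k <;> ext i j <;> fin_cases i <;> fin_cases j <;> simp [XY, pX, pY]

lemma XY_anticomm {k l : Fin 2} (h : k ≠ l) : XY k * XY l = -(XY l * XY k) := by
  fin_cases k <;> fin_cases l <;> first
    | exact absurd rfl h
    | ext i j; fin_cases i <;> fin_cases j <;> simp [XY, pX, pY]

/-- The square of a real combination of anticommuting involutions is scalar. -/
lemma sq_sum_smul_of_anticomm {R ι : Type*} [Ring R] [Algebra ℝ R]
    (s : Finset ι) (A : ι → R) (t : ι → ℝ) (hsq : ∀ i, A i * A i = 1)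
    (hanti : ∀ i j, i ≠ j → A i * A j = -(A j * A i)) :
    (∑ i ∈ s, t i • A i) * (∑ i ∈ s, t i • A i) = (∑ i ∈ s, t i ^ 2) • (1 : R) := by
  classical
  induction s using Finset.induction_on with
  | empty => simp
  | insert i s hi ih =>
    have hcross : t i • A i * (∑ j ∈ s, t j • A j) = -((∑ j ∈ s, t j • A j) * (t i • A i)) := by
      rw [Finset.mul_sum, Finset.sum_mul, ← Finset.sum_neg_distrib]
      refine Finset.sum_congr rfl fun j hj => ?_
      rw [smul_mul_smul_comm, smul_mul_smul_comm, hanti i j (fun h => hi (h ▸ hj)), smul_neg,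
        mul_comm (t i)]
    rw [Finset.sum_insert hi, Finset.sum_insert hi, add_mul, mul_add, mul_add, ih, hcross,
      smul_mul_smul_comm, hsq, add_smul, pow_two]
    abel

/-- Correlation complementarity: the squared expectation values of pairwise anticommuting
Hermitian involutions in a state add up to at most one. -/
lemma sum_sq_trace_le_one {m ι : Type*} [Fintype m] [DecidableEq m] [Fintype ι]
    {ρ : Matrix m m ℂ} (hρ : ρ.PosSemidef) (htr : ρ.trace = 1) (A : ι → Matrix m m ℂ)
    (hA : ∀ i, (A i).IsHermitian) (hsq : ∀ i, A i * A i = 1)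
    (hanti : ∀ i j, i ≠ j → A i * A j = -(A j * A i)) :
    ∑ i, (ρ * A i).trace.re ^ 2 ≤ 1 := by
  set t : ι → ℝ := fun i => (ρ * A i).trace.re with ht
  set S : Matrix m m ℂ := ∑ i, t i • A i with hS
  have hSH : Sᴴ = S := by
    rw [hS, Matrix.conjTranspose_sum]
    refine Finset.sum_congr rfl fun i _ => ?_
    rw [Matrix.conjTranspose_smul, star_trivial, (hA i).eq]
  have hSS : S * S = (∑ i, t i ^ 2) • (1 : Matrix m m ℂ) :=
    sq_sum_smul_of_anticomm Finset.univ A t hsq hanti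
  have hρS : (ρ * S).trace.re = ∑ i, t i ^ 2 := by
    rw [hS, Finset.mul_sum, Matrix.trace_sum, Complex.re_sum]
    refine Finset.sum_congr rfl fun i _ => ?_
    rw [Matrix.mul_smul, Matrix.trace_smul, Complex.smul_re, smul_eq_mul, pow_two]
  have hpos : 0 ≤ (ρ * ((S - 1) * (S - 1))).trace.re := by
    have h := (hρ.conjTranspose_mul_mul_same (S - 1)).trace_nonneg
    rw [Matrix.conjTranspose_sub, hSH, Matrix.conjTranspose_one, Matrix.mul_assoc,
      Matrix.trace_mul_comm, Matrix.mul_assoc] at h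
    exact (Complex.le_def.mp h).1
  have hexp : ρ * ((S - 1) * (S - 1)) = (∑ i, t i ^ 2) • ρ - ρ * S - ρ * S + ρ := by
    have : (S - 1) * (S - 1) = S * S - S - S + 1 := by noncomm_ring
    rw [this, hSS, mul_add, mul_sub, mul_sub, Matrix.mul_smul, mul_one]
  rw [hexp, Matrix.trace_add, Matrix.trace_sub, Matrix.trace_sub, Matrix.trace_smul, htr] at hpos
  simp only [Complex.add_re, Complex.sub_re, Complex.smul_re, Complex.one_re, smul_eq_mul, mul_one,
    hρS] at hpos
  change ∑ i, t i ^ 2 ≤ 1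
  linarith

/-- For fixed `k, l`, four pairwise anticommuting Pauli strings: two supported on the first triple
with `XY k` on the shared qubit, two on the second triple with the other Pauli matrix there. -/
def sharedStrings (k l : Fin 2) (q : Fin 2 × Fin 2) : Fin 5 → Matrix (Fin 2) (Fin 2) ℂ :=
  if q.1 = 0 then ![XY k, XY l, XY q.2, 1, 1] else ![XY (1 - k), 1, 1, XY l, XY q.2]

lemma piKron_sharedStrings_zero (k l p : Fin 2) :
    piKron (sharedStrings k l (0, p)) =
      onQubit (XY k) 0 * onQubit (XY l) 1 * onQubit (XY p) 2 := by
  simp only [onQubit_eq_piKron, piKron_mul]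
  congr 1
  funext s
  fin_cases s <;> simp [sharedStrings]

lemma piKron_sharedStrings_one (k l p : Fin 2) :
    piKron (sharedStrings k l (1, p)) =
      onQubit (XY (1 - k)) 0 * onQubit (XY l) 3 * onQubit (XY p) 4 := by
  simp only [onQubit_eq_piKron, piKron_mul]
  congr 1
  funext s
  fin_cases s <;> simp [sharedStrings]

lemma sharedStrings_anticomm (k l : Fin 2) {q r : Fin 2 × Fin 2} (h : q ≠ r) :
    piKron (sharedStrings k l q) * piKron (sharedStrings k l r) =
      -(piKron (sharedStrings k l r) * piKron (sharedStrings k l q)) := by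
  obtain ⟨t, p⟩ := q
  obtain ⟨t', p'⟩ := r
  have hk : k ≠ 1 - k := by fin_cases k <;> decide
  by_cases htt : t = t'
  · subst htt
    have hp : p ≠ p' := fun e => h (by rw [e])
    by_cases h0 : t = 0
    · refine piKron_anticomm 2 ?_ fun s hs => ?_
      · simpa [sharedStrings, h0] using XY_anticomm hp
      · fin_cases s <;> simp_all [sharedStrings]
    · refine piKron_anticomm 4 ?_ fun s hs => ?_
      · simpa [sharedStrings, h0] using XY_anticomm hp
      · fin_cases s <;> simp_all [sharedStrings]
  · refine piKron_anticomm 0 ?_ fun s hs => ?_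
    · fin_cases t <;> fin_cases t' <;> first
        | exact absurd rfl htt
        | simpa [sharedStrings] using XY_anticomm hk
        | simpa [sharedStrings] using XY_anticomm hk.symm
    · fin_cases t <;> fin_cases t' <;> first
        | exact absurd rfl htt
        | fin_cases s <;> simp_all [sharedStrings]

lemma sharedStrings_bound {ρ : Matrix (Fin 5 → Fin 2) (Fin 5 → Fin 2) ℂ}
    (hρ : IsDensityMatrix ρ) (k l : Fin 2) :
    ∑ p : Fin 2, ((ρ * (onQubit (XY k) 0 * onQubit (XY l) 1 * onQubit (XY p) 2)).trace.re) ^ 2 +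
      ∑ p : Fin 2,
        ((ρ * (onQubit (XY (1 - k)) 0 * onQubit (XY l) 3 * onQubit (XY p) 4)).trace.re) ^ 2 ≤ 1 := by
  have h := sum_sq_trace_le_one hρ.1 hρ.2 (fun q => piKron (sharedStrings k l q))
    (fun q => piKron_isHermitian fun s => by
      unfold sharedStrings
      split_ifs <;> fin_cases s <;> simp [XY_isHermitian])
    (fun q => by
      rw [piKron_mul, ← piKron_one]
      congr 1
      funext s
      unfold sharedStrings
      split_ifs <;> fin_cases s <;> simp [XY_mul_self])
    (fun q r hqr => sharedStrings_anticomm k l hqr)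
  simpa only [Fintype.sum_prod_type, Fin.sum_univ_two (fun t => ∑ p : Fin 2, _),
    piKron_sharedStrings_zero, piKron_sharedStrings_one] using h

/-- **Tripartite monogamy with one shared qubit.** For every 5-qubit density matrix,
𝒯²₁₂₃(ρ) + 𝒯²₁₄₅(ρ) ≤ 4. -/
theorem tripartite_monogamy_one_shared (ρ : Matrix (Fin 5 → Fin 2) (Fin 5 → Fin 2) ℂ)
    (hρ : IsDensityMatrix ρ) :
    T2triple ρ 0 1 2 + T2triple ρ 0 3 4 ≤ 4 := by
  have h00 := sharedStrings_bound hρ 0 0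
  have h01 := sharedStrings_bound hρ 0 1
  have h10 := sharedStrings_bound hρ 1 0
  have h11 := sharedStrings_bound hρ 1 1
  rw [sub_zero] at h00 h01
  rw [sub_self] at h10 h11
  rw [T2triple, T2triple]
  simp only [Fin.sum_univ_two] at *
  linarith
end
end

section
/- Six-qubit four-term tripartite monogamy: For every 6-qubit density matrix ρ, the xy-plane Bell strengths of the triples (1,2,3), (1,4,5), (1,3,5) and (3,5,6) satisfy 𝒯²₁₂₃(ρ) + 𝒯²₁₄₅(ρ) + 𝒯²₁₃₅(ρ) + 𝒯²₃₅₆(ρ) ≤ 4. -/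
open Matrix Complex ComplexOrder

noncomputable section

/-- The tensor product of a family of single-qubit operators. -/
def tensorOp {n : ℕ} (f : Fin n → Matrix (Fin 2) (Fin 2) ℂ) :
    Matrix (Fin n → Fin 2) (Fin n → Fin 2) ℂ :=
  Matrix.of fun a b => ∏ s, f s (a s) (b s)

theorem tensorOp_mul {n : ℕ} (f g : Fin n → Matrix (Fin 2) (Fin 2) ℂ) :
    tensorOp f * tensorOp g = tensorOp fun s => f s * g s := by
  ext a b
  simp only [tensorOp, Matrix.mul_apply, Matrix.of_apply, ← Finset.prod_mul_distrib]
  exact (Fintype.prod_sum fun s x => f s (a s) x * g s x (b s)).symm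

theorem tensorOp_one {n : ℕ} :
    tensorOp (fun _ : Fin n => (1 : Matrix (Fin 2) (Fin 2) ℂ)) = 1 := by
  ext a b
  by_cases h : a = b
  · subst h
    simp [tensorOp]
  · obtain ⟨s, hs⟩ := Function.ne_iff.mp h
    rw [Matrix.one_apply_ne h]
    exact Finset.prod_eq_zero (Finset.mem_univ s) (Matrix.one_apply_ne hs)

theorem tensorOp_smul {n : ℕ} (c : Fin n → ℤ) (f : Fin n → Matrix (Fin 2) (Fin 2) ℂ) :
    tensorOp (fun s => c s • f s) = (∏ s, c s) • tensorOp f := by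
  ext a b
  simp [tensorOp, Finset.prod_mul_distrib]

theorem tensorOp_isHermitian {n : ℕ} {f : Fin n → Matrix (Fin 2) (Fin 2) ℂ}
    (hf : ∀ s, (f s).IsHermitian) : (tensorOp f).IsHermitian := by
  ext a b
  simp only [tensorOp, Matrix.conjTranspose_apply, Matrix.of_apply, star_prod]
  exact Finset.prod_congr rfl fun s _ => (hf s).apply _ _

theorem onQubit_eq_tensorOp {n : ℕ} (M : Matrix (Fin 2) (Fin 2) ℂ) (i : Fin n) :
    onQubit M i = tensorOp fun s => if s = i then M else 1 := by
  ext a b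
  simp only [onQubit, tensorOp, Matrix.of_apply]
  refine Finset.prod_congr rfl fun s _ => ?_
  split_ifs <;> simp [Matrix.one_apply, *]

/-- The identity for the letter `none`, and `pX` or `pY` for the two other letters. -/
def pauliLetter : Option (Fin 2) → Matrix (Fin 2) (Fin 2) ℂ
  | none => 1
  | some k => XY k

/-- The commutation sign of two letters. -/
def letterSign : Option (Fin 2) → Option (Fin 2) → ℤ
  | some k, some l => if k = l then 1 else -1
  | _, _ => 1

theorem pauliLetter_mul_self (u : Option (Fin 2)) : pauliLetter u * pauliLetter u = 1 := by
  rcases u with _ | k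
  · simp [pauliLetter]
  · fin_cases k <;> simp [pauliLetter, XY, pX, pY, Matrix.one_fin_two]

theorem pauliLetter_isHermitian (u : Option (Fin 2)) : (pauliLetter u).IsHermitian := by
  rcases u with _ | k
  · exact Matrix.isHermitian_one
  · ext i j
    fin_cases k <;> fin_cases i <;> fin_cases j <;> simp [pauliLetter, XY, pX, pY]

theorem pauliLetter_mul_comm (u v : Option (Fin 2)) :
    pauliLetter u * pauliLetter v = letterSign u v • (pauliLetter v * pauliLetter u) := by
  rcases u with _ | k
  · simp [pauliLetter, letterSign]
  rcases v with _ | l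
  · simp [pauliLetter, letterSign]
  fin_cases k <;> fin_cases l <;> simp [pauliLetter, letterSign, XY, pX, pY]

/-- The operator spelled by a word of letters. -/
def pauliString {n : ℕ} (w : Fin n → Option (Fin 2)) :
    Matrix (Fin n → Fin 2) (Fin n → Fin 2) ℂ :=
  tensorOp fun s => pauliLetter (w s)

theorem pauliString_mul_self {n : ℕ} (w : Fin n → Option (Fin 2)) :
    pauliString w * pauliString w = 1 := by
  simp only [pauliString, tensorOp_mul, pauliLetter_mul_self, tensorOp_one]

theorem pauliString_isHermitian {n : ℕ} (w : Fin n → Option (Fin 2)) :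
    (pauliString w).IsHermitian :=
  tensorOp_isHermitian fun _ => pauliLetter_isHermitian _

theorem pauliString_anticomm {n : ℕ} {w v : Fin n → Option (Fin 2)}
    (h : ∏ s, letterSign (w s) (v s) = -1) :
    pauliString w * pauliString v = -(pauliString v * pauliString w) := by
  simp only [pauliString, tensorOp_mul]
  simp only [pauliLetter_mul_comm (w _) (v _)]
  rw [tensorOp_smul, h, neg_one_smul]

theorem onQubit_mul_mul_eq_pauliString {n : ℕ} {i j m : Fin n} (hij : i ≠ j) (him : i ≠ m)
    (hjm : j ≠ m) (k l p : Fin 2) :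
    onQubit (XY k) i * onQubit (XY l) j * onQubit (XY p) m =
      pauliString fun s => if s = i then some k else if s = j then some l
        else if s = m then some p else none := by
  simp only [onQubit_eq_tensorOp, tensorOp_mul, pauliString]
  congr 1
  funext s
  split_ifs <;> simp_all [pauliLetter]

theorem sum_mul_sum_of_anticomm {ι m : Type*} [Fintype ι] [DecidableEq ι] [Fintype m]
    [DecidableEq m] {A : ι → Matrix m m ℂ} (hsq : ∀ i, A i * A i = 1)
    (hanti : ∀ i j, i ≠ j → A i * A j = -(A j * A i)) (t : ι → ℝ) :
    (∑ i, t i • A i) * ∑ i, t i • A i = (∑ i, t i ^ 2) • (1 : Matrix m m ℂ) := by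
  have hpair : ∀ i j, (t i • A i) * (t j • A j) + (t j • A j) * (t i • A i) =
      if i = j then (2 * t i ^ 2) • (1 : Matrix m m ℂ) else 0 := by
    intro i j
    split_ifs with h
    · subst h
      simp only [smul_mul_smul_comm, hsq, ← add_smul]
      congr 1
      ring
    · simp only [smul_mul_smul_comm, hanti i j h, smul_neg, mul_comm (t j)]
      exact neg_add_cancel _
  have hdouble : (2 : ℝ) • ((∑ i, t i • A i) * ∑ i, t i • A i) =
      (2 : ℝ) • ((∑ i, t i ^ 2) • (1 : Matrix m m ℂ)) := by
    calc (2 : ℝ) • ((∑ i, t i • A i) * ∑ i, t i • A i)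
        = ∑ i, ∑ j, ((t i • A i) * (t j • A j) + (t j • A j) * (t i • A i)) := by
          simp only [Finset.sum_add_distrib]
          rw [Finset.sum_comm (f := fun i j => (t j • A j) * (t i • A i)),
            ← Finset.sum_mul_sum, two_smul]
      _ = (2 : ℝ) • ((∑ i, t i ^ 2) • (1 : Matrix m m ℂ)) := by
          simp only [hpair, Finset.sum_ite_eq, Finset.mem_univ, if_true, mul_smul,
            Finset.sum_smul, Finset.smul_sum]
  exact smul_right_injective _ (two_ne_zero (α := ℝ)) hdouble

/-- Squared expectation values of pairwise anticommuting observables sum to at most one. -/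
theorem sum_sq_expectation_le_one {ι m : Type*} [Fintype ι] [DecidableEq ι] [Fintype m]
    [DecidableEq m] {ρ : Matrix m m ℂ} (hρ : ρ.PosSemidef) (htr : ρ.trace = 1)
    {A : ι → Matrix m m ℂ} (hA : ∀ i, (A i).IsHermitian) (hsq : ∀ i, A i * A i = 1)
    (hanti : ∀ i j, i ≠ j → A i * A j = -(A j * A i)) :
    ∑ i, ((ρ * A i).trace.re) ^ 2 ≤ 1 := by
  set t : ι → ℝ := fun i => (ρ * A i).trace.re
  set s : ℝ := ∑ i, t i ^ 2
  set H : Matrix m m ℂ := ∑ i, t i • A i with hH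
  have hHH : H * H = s • 1 := sum_mul_sum_of_anticomm hsq hanti t
  have hHherm : Hᴴ = H := by
    simp only [hH, Matrix.conjTranspose_sum, Matrix.conjTranspose_smul, (hA _).eq, star_trivial]
  have hexp : (ρ * H).trace.re = s := by
    simp only [hH, Finset.mul_sum, Matrix.trace_sum, Matrix.mul_smul, Matrix.trace_smul,
      Complex.re_sum, Complex.smul_re, s, smul_eq_mul, pow_two]
    rfl
  set B : Matrix m m ℂ := H - s • 1 with hB
  have hBherm : Bᴴ = B := by
    simp [hB, hHherm, Matrix.conjTranspose_smul]
  have hBB : B * B = (s + s ^ 2) • (1 : Matrix m m ℂ) - (2 * s) • H := by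
    simp only [hB, sub_mul, mul_sub, hHH, smul_mul_assoc, mul_smul_comm, one_mul, mul_one]
    module
  have hnonneg : 0 ≤ (ρ * (B * B)).trace.re := by
    have h := (hρ.conjTranspose_mul_mul_same B).trace_nonneg
    rw [hBherm, Matrix.trace_mul_comm, ← mul_assoc, Matrix.trace_mul_comm] at h
    exact (Complex.le_def.mp h).1
  have hval : (ρ * (B * B)).trace.re = s - s ^ 2 := by
    rw [hBB]
    simp only [mul_sub, Matrix.mul_smul, Matrix.trace_sub, Matrix.trace_smul, mul_one, htr,
      Complex.sub_re, Complex.smul_re, hexp, Complex.one_re, smul_eq_mul]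
    ring
  nlinarith

/-- Eight pairwise anticommuting six-letter words, two on each of the four qubit triples. -/
def cliqueWord (a b : Fin 2) : Fin 8 → Fin 6 → Option (Fin 2) :=
  ![![some a, some 0, some b, none, none, none],
    ![some a, some 1, some b, none, none, none],
    ![some (a + 1), none, none, some 0, some (a + b), none],
    ![some (a + 1), none, none, some 1, some (a + b), none],
    ![some a, none, some (b + 1), none, some (a + b), none],
    ![some (a + 1), none, some b, none, some (a + b + 1), none],
    ![none, none, some (b + 1), none, some (a + b + 1), some 0],
    ![none, none, some (b + 1), none, some (a + b + 1), some 1]]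

theorem cliqueWord_sign : ∀ a b : Fin 2, ∀ i j : Fin 8, i ≠ j →
    ∏ s, letterSign (cliqueWord a b i s) (cliqueWord a b j s) = -1 := by
  simp only [Fin.prod_univ_six]
  decide

theorem cliqueWord_sum_le_one {ρ : Matrix (Fin 6 → Fin 2) (Fin 6 → Fin 2) ℂ}
    (hρ : IsDensityMatrix ρ) (a b : Fin 2) :
    ∑ i, ((ρ * pauliString (cliqueWord a b i)).trace.re) ^ 2 ≤ 1 :=
  sum_sq_expectation_le_one hρ.1 hρ.2 (fun _ => pauliString_isHermitian _)
    (fun _ => pauliString_mul_self _)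
    fun i j hij => pauliString_anticomm (cliqueWord_sign a b i j hij)

theorem T2triple_eq {n : ℕ} (ρ : Matrix (Fin n → Fin 2) (Fin n → Fin 2) ℂ) {i j m : Fin n}
    (hij : i ≠ j) (him : i ≠ m) (hjm : j ≠ m) :
    T2triple ρ i j m = ∑ k : Fin 2, ∑ l : Fin 2, ∑ p : Fin 2,
      ((ρ * pauliString fun s => if s = i then some k else if s = j then some l
        else if s = m then some p else none).trace.re) ^ 2 := by
  simp only [T2triple, onQubit_mul_mul_eq_pauliString hij him hjm]

/-- **Six-qubit four-term tripartite monogamy.** For every 6-qubit density matrix,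
𝒯²₁₂₃(ρ) + 𝒯²₁₄₅(ρ) + 𝒯²₁₃₅(ρ) + 𝒯²₃₅₆(ρ) ≤ 4. -/
theorem six_qubit_tripartite_monogamy (ρ : Matrix (Fin 6 → Fin 2) (Fin 6 → Fin 2) ℂ)
    (hρ : IsDensityMatrix ρ) :
    T2triple ρ 0 1 2 + T2triple ρ 0 3 4 + T2triple ρ 0 2 4 + T2triple ρ 2 4 5 ≤ 4 := by
  have h123 (k l p : Fin 2) : (fun s : Fin 6 => if s = 0 then some k else if s = 1 then some l
      else if s = 2 then some p else none) = ![some k, some l, some p, none, none, none] := by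
    ext1 s; fin_cases s <;> rfl
  have h145 (k l p : Fin 2) : (fun s : Fin 6 => if s = 0 then some k else if s = 3 then some l
      else if s = 4 then some p else none) = ![some k, none, none, some l, some p, none] := by
    ext1 s; fin_cases s <;> rfl
  have h135 (k l p : Fin 2) : (fun s : Fin 6 => if s = 0 then some k else if s = 2 then some l
      else if s = 4 then some p else none) = ![some k, none, some l, none, some p, none] := by
    ext1 s; fin_cases s <;> rfl
  have h356 (k l p : Fin 2) : (fun s : Fin 6 => if s = 2 then some k else if s = 4 then some l
      else if s = 5 then some p else none) = ![none, none, some k, none, some l, some p] := by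
    ext1 s; fin_cases s <;> rfl
  have hadd : (1 : Fin 2) + 1 = 0 := rfl
  have h00 := cliqueWord_sum_le_one hρ 0 0
  have h01 := cliqueWord_sum_le_one hρ 0 1
  have h10 := cliqueWord_sum_le_one hρ 1 0
  have h11 := cliqueWord_sum_le_one hρ 1 1
  simp only [Fin.sum_univ_eight, cliqueWord, Matrix.cons_val, zero_add, add_zero, hadd]
    at h00 h01 h10 h11
  rw [T2triple_eq ρ (by decide) (by decide) (by decide),
    T2triple_eq ρ (by decide) (by decide) (by decide),
    T2triple_eq ρ (by decide) (by decide) (by decide),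
    T2triple_eq ρ (by decide) (by decide) (by decide)]
  simp only [h123, h145, h135, h356, Fin.sum_univ_two]
  linarith
end
end
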